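/- Let E be a COSEA, a∈S_1(E) and b∈S(E). Then a∘b=b∘a if and only if a∘b=0 or a≤b. -/

import Mathlib

set_option linter.unusedVariables false

universe u v

theorem prod_eq' {α β : Type*} {p q : α × β} (h1 : p.1 = q.1) (h2 : p.2 = q.2) : p = q :=
  Prod.ext_iff.mpr ⟨h1, h2⟩

/-- A convex sequential effect algebra (COSEA).  The partial sum `⊕` is modelled by a
total operation `oplus` together with a definedness predicate `perp`; all axioms only
constrain `oplus` on pairs satisfying `perp`.  The scalar action is modelled by a total
map `smul : ℝ → E → E`, with axioms imposed for scalars in `[0,1]`. -/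
structure COSEA (E : Type u) where
  zero : E
  one : E
  perp : E → E → Prop
  oplus : E → E → E
  compl : E → E
  smul : ℝ → E → E
  seq : E → E → E
  -- effect algebra axioms
  perp_comm : ∀ a b, perp a b → perp b a
  oplus_comm : ∀ a b, perp a b → oplus a b = oplus b a
  perp_assoc_right : ∀ a b c, perp a b → perp (oplus a b) c → perp b c
  perp_assoc_left : ∀ a b c, perp a b → perp (oplus a b) c → perp a (oplus b c)
  oplus_assoc : ∀ a b c, perp a b → perp (oplus a b) c →
    oplus a (oplus b c) = oplus (oplus a b) c
  perp_compl : ∀ a, perp a (compl a)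
  oplus_compl : ∀ a, oplus a (compl a) = one
  compl_unique : ∀ a b, perp a b → oplus a b = one → b = compl a
  perp_one : ∀ a, perp a one → a = zero
  -- convexity axioms
  smul_smul : ∀ α β a, 0 ≤ α → α ≤ 1 → 0 ≤ β → β ≤ 1 →
    smul α (smul β a) = smul (α * β) a
  perp_smul_self : ∀ α β a, 0 ≤ α → 0 ≤ β → α + β ≤ 1 → perp (smul α a) (smul β a)
  add_smul : ∀ α β a, 0 ≤ α → 0 ≤ β → α + β ≤ 1 →
    smul (α + β) a = oplus (smul α a) (smul β a)
  perp_smul : ∀ lam a b, 0 ≤ lam → lam ≤ 1 → perp a b → perp (smul lam a) (smul lam b)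
  smul_oplus : ∀ lam a b, 0 ≤ lam → lam ≤ 1 → perp a b →
    smul lam (oplus a b) = oplus (smul lam a) (smul lam b)
  one_smul : ∀ a, smul 1 a = a
  -- sequential product axioms
  seq_perp : ∀ a b c, perp b c → perp (seq a b) (seq a c)
  seq_oplus : ∀ a b c, perp b c → seq a (oplus b c) = oplus (seq a b) (seq a c)
  one_seq : ∀ a, seq one a = a
  seq_eq_zero_comm : ∀ a b, seq a b = zero → seq b a = seq a b
  comm_compl : ∀ a b, seq a b = seq b a → seq a (compl b) = seq (compl b) a
  comm_assoc : ∀ a b c, seq a b = seq b a → seq a (seq b c) = seq (seq a b) c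
  comm_seq : ∀ a b c, seq c a = seq a c → seq c b = seq b c →
    seq c (seq a b) = seq (seq a b) c
  comm_oplus : ∀ a b c, seq c a = seq a c → seq c b = seq b c → perp a b →
    seq c (oplus a b) = seq (oplus a b) c
  smul_seq : ∀ lam a b, 0 ≤ lam → lam ≤ 1 → seq (smul lam a) b = smul lam (seq a b)
  seq_smul : ∀ lam a b, 0 ≤ lam → lam ≤ 1 → seq a (smul lam b) = smul lam (seq a b)

/-- `SumList C l s` : the orthogonal sum of the list `l` is defined and equals `s`. -/
inductive COSEA.SumList {E : Type u} (C : COSEA E) : List E → E → Prop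
  | nil : COSEA.SumList C [] C.zero
  | cons {a : E} {l : List E} {s : E} :
      COSEA.SumList C l s → C.perp a s → COSEA.SumList C (a :: l) (C.oplus a s)

namespace COSEA

variable {E : Type u}

/-- `a ≤ b` in the effect-algebra order. -/
def le (C : COSEA E) (a b : E) : Prop := ∃ c, C.perp a c ∧ C.oplus a c = b

/-- `a` is sharp: the greatest lower bound of `a` and `a'` is `0`,
i.e. every common lower bound of `a` and `a'` lies below `0`. -/
def IsSharp (C : COSEA E) (a : E) : Prop :=
  ∀ c, C.le c a → C.le c (C.compl a) → C.le c C.zero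

/-- `a` is a one-dimensional (atomic) sharp element. -/
def IsOneDim (C : COSEA E) (a : E) : Prop :=
  C.IsSharp a ∧ a ≠ C.zero ∧
    ∀ b, C.le b a → ∃ lam : ℝ, 0 ≤ lam ∧ lam ≤ 1 ∧ b = C.smul lam a

/-- A state on a COSEA. -/
def IsState (C : COSEA E) (ω : E → ℝ) : Prop :=
  (∀ a, 0 ≤ ω a ∧ ω a ≤ 1) ∧ ω C.one = 1 ∧
    ∀ a b, C.perp a b → ω (C.oplus a b) = ω a + ω b

/-- A context presented as an injective finite enumeration of one-dimensional
elements summing to `1`. -/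
def IsContextFun (C : COSEA E) {n : ℕ} (a : Fin n → E) : Prop :=
  Function.Injective a ∧ (∀ i, C.IsOneDim (a i)) ∧ C.SumList (List.ofFn a) C.one

/-- A context as a set of effects. -/
def IsContext (C : COSEA E) (A : Set E) : Prop :=
  ∃ (n : ℕ) (a : Fin n → E), C.IsContextFun a ∧ Set.range a = A

/-- `E` is finite-dimensional: there is no infinite sequence of one-dimensional
elements all of whose initial partial orthogonal sums are defined. -/
def FinDim (C : COSEA E) : Prop :=
  ¬ ∃ f : ℕ → E, (∀ i, C.IsOneDim (f i)) ∧
      ∀ n : ℕ, ∃ s, C.SumList ((List.range n).map f) s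

/-- `E` is state-unique. -/
def StateUnique (C : COSEA E) : Prop :=
  ∀ a, C.IsOneDim a → ∃! ω : E → ℝ, C.IsState ω ∧ ω a = 1

/-- `E` is symmetric : `â(b) = b̂(a)` for all one-dimensional `a, b`. -/
def Symm (C : COSEA E) : Prop :=
  ∀ a b ω ρ, C.IsOneDim a → C.IsOneDim b → C.IsState ω → C.IsState ρ →
    ω a = 1 → ρ b = 1 → ω b = ρ a

/-- `b = λ₁ a₁ ⊕ ⋯ ⊕ λₙ aₙ` with all `λ i ∈ [0,1]`. -/
def SpanRep (C : COSEA E) {n : ℕ} (a : Fin n → E) (lam : Fin n → ℝ) (b : E) : Prop :=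
  (∀ i, 0 ≤ lam i ∧ lam i ≤ 1) ∧
    C.SumList (List.ofFn fun i => C.smul (lam i) (a i)) b

/-- `b ∈ E(A)` : `b` has a representation over the context `A`. -/
def InSpan (C : COSEA E) (A : Set E) (b : E) : Prop :=
  ∃ (n : ℕ) (a : Fin n → E) (lam : Fin n → ℝ),
    C.IsContextFun a ∧ Set.range a = A ∧ C.SpanRep a lam b

/-- `E` is spectral. -/
def Spectral (C : COSEA E) : Prop :=
  C.StateUnique ∧ ∀ b, ∃ A, C.IsContext A ∧ C.InSpan A b

/-- The commutant of a subset. -/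
def commutant (C : COSEA E) (F : Set E) : Set E :=
  {b | ∀ a ∈ F, C.seq b a = C.seq a b}

/-- The center `E' = {b : b ∘ a = a ∘ b for all a}`. -/
def center (C : COSEA E) : Set E := C.commutant Set.univ

/-- `E` is a factor: the center consists of the effects `λ 1`, `λ ∈ [0,1]`. -/
def IsFactor (C : COSEA E) : Prop :=
  C.center = {b | ∃ lam : ℝ, 0 ≤ lam ∧ lam ≤ 1 ∧ b = C.smul lam C.one}

/-- Sub-COSEA. -/
def IsSubCOSEA (C : COSEA E) (F : Set E) : Prop :=
  C.zero ∈ F ∧ C.one ∈ F ∧ (∀ a ∈ F, C.compl a ∈ F) ∧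
    (∀ lam : ℝ, 0 ≤ lam → lam ≤ 1 → ∀ a ∈ F, C.smul lam a ∈ F) ∧
    (∀ a ∈ F, ∀ b ∈ F, C.perp a b → C.oplus a b ∈ F) ∧
    (∀ a ∈ F, ∀ b ∈ F, C.seq a b ∈ F)

/-- `a` is a minimal sharp element of `F`. -/
def MinSharp (C : COSEA E) (F : Set E) (a : E) : Prop :=
  a ∈ F ∧ C.IsSharp a ∧ a ≠ C.zero ∧
    ∀ b ∈ F, C.IsSharp b → b ≠ C.zero → C.le b a → b = a

/-- COSEA isomorphism. -/
def IsIso {F : Type u} (C : COSEA E) (D : COSEA F) (φ : E → F) : Prop :=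
  Function.Bijective φ ∧ φ C.one = D.one ∧
    (∀ a b, C.perp a b ↔ D.perp (φ a) (φ b)) ∧
    (∀ a b, C.perp a b → φ (C.oplus a b) = D.oplus (φ a) (φ b)) ∧
    (∀ lam : ℝ, 0 ≤ lam → lam ≤ 1 → ∀ a, φ (C.smul lam a) = D.smul lam (φ a)) ∧
    (∀ a b, φ (C.seq a b) = D.seq (φ a) (φ b))

/-- `lam` is an eigenvalue of `b` : `lam = â(b)` for some eigeneffect `a` of `b`. -/
def IsEigenvalue (C : COSEA E) (b : E) (lam : ℝ) : Prop :=
  ∃ (a : E) (ω : E → ℝ), C.IsOneDim a ∧ C.seq a b = C.seq b a ∧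
    C.IsState ω ∧ ω a = 1 ∧ lam = ω b

/-- The spectrum of `b`. -/
def spectrum (C : COSEA E) (b : E) : Set ℝ := {lam | C.IsEigenvalue b lam}

/-- `c = ⌈a⌉` : `c` is the least sharp element dominating `a`. -/
def IsCeil (C : COSEA E) (a c : E) : Prop :=
  C.IsSharp c ∧ C.le a c ∧ ∀ d, C.IsSharp d → C.le a d → C.le c d

/-- `b` is a pseudo-inverse of `a` with scalar `lam` :
`⌈b⌉ = ⌈a⌉`, `‖b‖ = 1` and `a ∘ b = b ∘ a = lam ⌈a⌉`. -/
def IsPseudoInvWith (C : COSEA E) (a b : E) (lam : ℝ) : Prop :=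
  (∃ ca, C.IsCeil a ca ∧ C.IsCeil b ca ∧
    C.seq a b = C.smul lam ca ∧ C.seq b a = C.smul lam ca) ∧
  IsGreatest (C.spectrum b) 1 ∧ 0 ≤ lam ∧ lam ≤ 1

/-- The conditional probability map `γ_a` (zero functionals are sent to `0`). -/
noncomputable def condProb (C : COSEA E) (a : E) (ω : E → ℝ) : E → ℝ :=
  fun c => if ω a = 0 then 0 else ω (C.seq a c) / ω a

/-- Membership in `Ω̂(E) = Ω(E) ∪ {0}`. -/
def InOmegaHat (C : COSEA E) (ω : E → ℝ) : Prop :=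
  C.IsState ω ∨ ω = fun _ => 0

/-- Direct sum of two COSEAs, with all operations componentwise. -/
def prod {E F : Type u} (C : COSEA E) (D : COSEA F) : COSEA (E × F) where
  zero := (C.zero, D.zero)
  one := (C.one, D.one)
  perp a b := C.perp a.1 b.1 ∧ D.perp a.2 b.2
  oplus a b := (C.oplus a.1 b.1, D.oplus a.2 b.2)
  compl a := (C.compl a.1, D.compl a.2)
  smul lam a := (C.smul lam a.1, D.smul lam a.2)
  seq a b := (C.seq a.1 b.1, D.seq a.2 b.2)
  perp_comm := fun a b h => ⟨C.perp_comm _ _ h.1, D.perp_comm _ _ h.2⟩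
  oplus_comm := fun a b h => prod_eq' (C.oplus_comm _ _ h.1) (D.oplus_comm _ _ h.2)
  perp_assoc_right := fun a b c h1 h2 =>
    ⟨C.perp_assoc_right _ _ _ h1.1 h2.1, D.perp_assoc_right _ _ _ h1.2 h2.2⟩
  perp_assoc_left := fun a b c h1 h2 =>
    ⟨C.perp_assoc_left _ _ _ h1.1 h2.1, D.perp_assoc_left _ _ _ h1.2 h2.2⟩
  oplus_assoc := fun a b c h1 h2 =>
    prod_eq' (C.oplus_assoc _ _ _ h1.1 h2.1) (D.oplus_assoc _ _ _ h1.2 h2.2)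
  perp_compl := fun a => ⟨C.perp_compl _, D.perp_compl _⟩
  oplus_compl := fun a => prod_eq' (C.oplus_compl _) (D.oplus_compl _)
  compl_unique := fun a b h he =>
    prod_eq' (C.compl_unique _ _ h.1 (congrArg Prod.fst he))
      (D.compl_unique _ _ h.2 (congrArg Prod.snd he))
  perp_one := fun a h => prod_eq' (C.perp_one _ h.1) (D.perp_one _ h.2)
  smul_smul := fun α β a h1 h2 h3 h4 =>
    prod_eq' (C.smul_smul _ _ _ h1 h2 h3 h4) (D.smul_smul _ _ _ h1 h2 h3 h4)
  perp_smul_self := fun α β a h1 h2 h3 =>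
    ⟨C.perp_smul_self _ _ _ h1 h2 h3, D.perp_smul_self _ _ _ h1 h2 h3⟩
  add_smul := fun α β a h1 h2 h3 =>
    prod_eq' (C.add_smul _ _ _ h1 h2 h3) (D.add_smul _ _ _ h1 h2 h3)
  perp_smul := fun lam a b h1 h2 h =>
    ⟨C.perp_smul _ _ _ h1 h2 h.1, D.perp_smul _ _ _ h1 h2 h.2⟩
  smul_oplus := fun lam a b h1 h2 h =>
    prod_eq' (C.smul_oplus _ _ _ h1 h2 h.1) (D.smul_oplus _ _ _ h1 h2 h.2)
  one_smul := fun a => prod_eq' (C.one_smul _) (D.one_smul _)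
  seq_perp := fun a b c h => ⟨C.seq_perp _ _ _ h.1, D.seq_perp _ _ _ h.2⟩
  seq_oplus := fun a b c h => prod_eq' (C.seq_oplus _ _ _ h.1) (D.seq_oplus _ _ _ h.2)
  one_seq := fun a => prod_eq' (C.one_seq _) (D.one_seq _)
  seq_eq_zero_comm := fun a b h =>
    prod_eq' (C.seq_eq_zero_comm _ _ (congrArg Prod.fst h))
      (D.seq_eq_zero_comm _ _ (congrArg Prod.snd h))
  comm_compl := fun a b h =>
    prod_eq' (C.comm_compl _ _ (congrArg Prod.fst h))
      (D.comm_compl _ _ (congrArg Prod.snd h))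
  comm_assoc := fun a b c h =>
    prod_eq' (C.comm_assoc _ _ _ (congrArg Prod.fst h))
      (D.comm_assoc _ _ _ (congrArg Prod.snd h))
  comm_seq := fun a b c h1 h2 =>
    prod_eq' (C.comm_seq _ _ _ (congrArg Prod.fst h1) (congrArg Prod.fst h2))
      (D.comm_seq _ _ _ (congrArg Prod.snd h1) (congrArg Prod.snd h2))
  comm_oplus := fun a b c h1 h2 hp =>
    prod_eq' (C.comm_oplus _ _ _ (congrArg Prod.fst h1) (congrArg Prod.fst h2) hp.1)
      (D.comm_oplus _ _ _ (congrArg Prod.snd h1) (congrArg Prod.snd h2) hp.2)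
  smul_seq := fun lam a b h1 h2 =>
    prod_eq' (C.smul_seq _ _ _ h1 h2) (D.smul_seq _ _ _ h1 h2)
  seq_smul := fun lam a b h1 h2 =>
    prod_eq' (C.seq_smul _ _ _ h1 h2) (D.seq_smul _ _ _ h1 h2)

/-- Direct sum of a family of COSEAs, with all operations componentwise. -/
def pi {ι : Type v} {E : ι → Type u} (C : ∀ i, COSEA (E i)) : COSEA (∀ i, E i) where
  zero := fun i => (C i).zero
  one := fun i => (C i).one
  perp a b := ∀ i, (C i).perp (a i) (b i)
  oplus a b := fun i => (C i).oplus (a i) (b i)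
  compl a := fun i => (C i).compl (a i)
  smul lam a := fun i => (C i).smul lam (a i)
  seq a b := fun i => (C i).seq (a i) (b i)
  perp_comm := fun a b h i => (C i).perp_comm _ _ (h i)
  oplus_comm := fun a b h => funext fun i => (C i).oplus_comm _ _ (h i)
  perp_assoc_right := fun a b c h1 h2 i => (C i).perp_assoc_right _ _ _ (h1 i) (h2 i)
  perp_assoc_left := fun a b c h1 h2 i => (C i).perp_assoc_left _ _ _ (h1 i) (h2 i)
  oplus_assoc := fun a b c h1 h2 => funext fun i => (C i).oplus_assoc _ _ _ (h1 i) (h2 i)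
  perp_compl := fun a i => (C i).perp_compl _
  oplus_compl := fun a => funext fun i => (C i).oplus_compl _
  compl_unique := fun a b h he =>
    funext fun i => (C i).compl_unique _ _ (h i) (congrFun he i)
  perp_one := fun a h => funext fun i => (C i).perp_one _ (h i)
  smul_smul := fun α β a h1 h2 h3 h4 =>
    funext fun i => (C i).smul_smul _ _ _ h1 h2 h3 h4
  perp_smul_self := fun α β a h1 h2 h3 i => (C i).perp_smul_self _ _ _ h1 h2 h3
  add_smul := fun α β a h1 h2 h3 => funext fun i => (C i).add_smul _ _ _ h1 h2 h3
  perp_smul := fun lam a b h1 h2 h i => (C i).perp_smul _ _ _ h1 h2 (h i)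
  smul_oplus := fun lam a b h1 h2 h =>
    funext fun i => (C i).smul_oplus _ _ _ h1 h2 (h i)
  one_smul := fun a => funext fun i => (C i).one_smul _
  seq_perp := fun a b c h i => (C i).seq_perp _ _ _ (h i)
  seq_oplus := fun a b c h => funext fun i => (C i).seq_oplus _ _ _ (h i)
  one_seq := fun a => funext fun i => (C i).one_seq _
  seq_eq_zero_comm := fun a b h =>
    funext fun i => (C i).seq_eq_zero_comm _ _ (congrFun h i)
  comm_compl := fun a b h => funext fun i => (C i).comm_compl _ _ (congrFun h i)
  comm_assoc := fun a b c h => funext fun i => (C i).comm_assoc _ _ _ (congrFun h i)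
  comm_seq := fun a b c h1 h2 =>
    funext fun i => (C i).comm_seq _ _ _ (congrFun h1 i) (congrFun h2 i)
  comm_oplus := fun a b c h1 h2 hp =>
    funext fun i => (C i).comm_oplus _ _ _ (congrFun h1 i) (congrFun h2 i) (hp i)
  smul_seq := fun lam a b h1 h2 => funext fun i => (C i).smul_seq _ _ _ h1 h2
  seq_smul := fun lam a b h1 h2 => funext fun i => (C i).seq_smul _ _ _ h1 h2

end COSEA

namespace COSEA

variable {E : Type u} (C : COSEA E)

theorem compl_compl (a : E) : C.compl (C.compl a) = a :=
  (C.compl_unique _ _ (C.perp_comm _ _ (C.perp_compl a))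
    ((C.oplus_comm _ _ (C.perp_comm _ _ (C.perp_compl a))).trans (C.oplus_compl a))).symm

theorem compl_one : C.compl C.one = C.zero :=
  C.perp_one _ (C.perp_comm _ _ (C.perp_compl C.one))

theorem perp_one_zero : C.perp C.one C.zero := by
  simpa only [compl_one] using C.perp_compl C.one

theorem oplus_one_zero : C.oplus C.one C.zero = C.one := by
  simpa only [compl_one] using C.oplus_compl C.one

theorem compl_zero : C.compl C.zero = C.one := by
  rw [← C.compl_one, C.compl_compl]

theorem perp_zero (a : E) : C.perp a C.zero := by
  have h := C.perp_assoc_right (C.compl a) a C.zero (C.perp_comm _ _ (C.perp_compl a))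
  rw [← C.oplus_comm _ _ (C.perp_compl a), C.oplus_compl] at h
  exact h C.perp_one_zero

theorem oplus_zero (a : E) : C.oplus a C.zero = a := by
  have hp := C.perp_comm _ _ (C.perp_compl a)
  have ho : C.oplus (C.compl a) a = C.one :=
    (C.oplus_comm _ _ hp).trans (C.oplus_compl a)
  have hz : C.perp (C.oplus (C.compl a) a) C.zero := ho ▸ C.perp_one_zero
  have h := C.compl_unique _ _ (C.perp_assoc_left _ _ _ hp hz)
    ((C.oplus_assoc _ _ _ hp hz).trans (by rw [ho, C.oplus_one_zero]))
  rwa [C.compl_compl] at h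

theorem oplus_right_cancel {a b c : E} (hac : C.perp a c) (hbc : C.perp b c)
    (h : C.oplus a c = C.oplus b c) : a = b := by
  have key : ∀ x, C.perp x c → C.oplus x c = C.oplus a c →
      C.oplus c (C.compl (C.oplus a c)) = C.compl x := by
    intro x hx hxa
    have hp : C.perp (C.oplus x c) (C.compl (C.oplus a c)) := hxa ▸ C.perp_compl _
    refine C.compl_unique _ _ (C.perp_assoc_left _ _ _ hx hp) ?_
    rw [C.oplus_assoc _ _ _ hx hp, hxa, C.oplus_compl]
  rw [← C.compl_compl a, ← key a hac rfl, key b hbc h.symm, C.compl_compl]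

theorem oplus_left_cancel {a b c : E} (hca : C.perp c a) (hcb : C.perp c b)
    (h : C.oplus c a = C.oplus c b) : a = b :=
  C.oplus_right_cancel (C.perp_comm _ _ hca) (C.perp_comm _ _ hcb)
    (by rw [← C.oplus_comm _ _ hca, ← C.oplus_comm _ _ hcb, h])

theorem eq_zero_of_oplus_self {a : E} (hp : C.perp a a) (h : C.oplus a a = a) :
    a = C.zero :=
  C.oplus_left_cancel hp (C.perp_zero a) (h.trans (C.oplus_zero a).symm)

theorem eq_zero_of_oplus_eq_zero {a b : E} (hp : C.perp a b)
    (h : C.oplus a b = C.zero) : a = C.zero := by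
  have hp' := C.perp_comm _ _ hp
  have h1 : C.perp (C.oplus b a) C.one := by
    rw [C.oplus_comm _ _ hp', h]
    exact C.perp_comm _ _ C.perp_one_zero
  exact C.perp_one _ (C.perp_assoc_right _ _ _ hp' h1)

theorem eq_zero_of_le_zero {a : E} (h : C.le a C.zero) : a = C.zero := by
  obtain ⟨c, hp, hc⟩ := h
  exact C.eq_zero_of_oplus_eq_zero hp hc

theorem zero_smul (a : E) : C.smul 0 a = C.zero := by
  have h := C.add_smul 0 0 a le_rfl le_rfl (by norm_num)
  rw [add_zero] at h
  exact C.eq_zero_of_oplus_self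
    (C.perp_smul_self 0 0 a le_rfl le_rfl (by norm_num)) h.symm

theorem smul_zero {r : ℝ} (h0 : 0 ≤ r) (h1 : r ≤ 1) : C.smul r C.zero = C.zero := by
  have h := C.smul_oplus r C.zero C.zero h0 h1 (C.perp_zero _)
  rw [C.oplus_zero] at h
  exact C.eq_zero_of_oplus_self (C.perp_smul r _ _ h0 h1 (C.perp_zero _)) h.symm

theorem eq_zero_of_smul_eq_zero {r : ℝ} {a : E} (h0 : 0 < r) (h1 : r ≤ 1)
    (h : C.smul r a = C.zero) : a = C.zero := by
  obtain ⟨n, hn⟩ := exists_nat_one_div_lt h0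
  have hN : (0 : ℝ) < (n : ℝ) + 1 := by positivity
  set d : ℝ := 1 / ((n : ℝ) + 1)
  have hd0 : 0 < d := by positivity
  have hdN : ((n : ℝ) + 1) * d = 1 := mul_one_div_cancel hN.ne'
  have hd : C.smul d a = C.zero := by
    have hq0 : 0 ≤ d / r := by positivity
    have hq1 : d / r ≤ 1 := (div_le_one h0).mpr hn.le
    have hs := C.smul_smul (d / r) r a hq0 hq1 h0.le h1
    rw [div_mul_cancel₀ _ h0.ne', h, C.smul_zero hq0 hq1] at hs
    exact hs.symm
  have hk : ∀ k : ℕ, k ≤ n + 1 → C.smul (k * d) a = C.zero := by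
    intro k
    induction k with
    | zero => intro _; simpa using C.zero_smul a
    | succ k ih =>
      intro hkn
      have hle : (k : ℝ) * d + d ≤ 1 := by
        rw [← hdN, ← add_one_mul]
        have : ((k : ℝ) + 1) ≤ (n : ℝ) + 1 := by exact_mod_cast hkn
        gcongr
      have hs := C.add_smul (k * d) d a (by positivity) hd0.le hle
      rw [ih (by omega), hd, C.oplus_zero] at hs
      rw [Nat.cast_succ, add_one_mul, hs]
  have hlast := hk (n + 1) le_rfl
  rwa [Nat.cast_succ, hdN, C.one_smul] at hlast

theorem seq_zero (a : E) : C.seq a C.zero = C.zero := by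
  have h := C.seq_oplus a C.zero C.zero (C.perp_zero _)
  rw [C.oplus_zero] at h
  exact C.eq_zero_of_oplus_self (C.seq_perp a _ _ (C.perp_zero _)) h.symm

theorem seq_one (a : E) : C.seq a C.one = a := by
  have h := C.comm_compl a C.zero (C.seq_eq_zero_comm _ _ (C.seq_zero a)).symm
  rwa [C.compl_zero, C.one_seq] at h

theorem seq_oplus_seq_compl (a b : E) :
    C.oplus (C.seq a b) (C.seq a (C.compl b)) = a := by
  rw [← C.seq_oplus _ _ _ (C.perp_compl b), C.oplus_compl, C.seq_one]

theorem seq_le_left (a b : E) : C.le (C.seq a b) a :=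
  ⟨_, C.seq_perp a _ _ (C.perp_compl b), C.seq_oplus_seq_compl a b⟩

variable {C}

theorem IsSharp.seq_compl {b : E} (hb : C.IsSharp b) : C.seq b (C.compl b) = C.zero := by
  refine C.eq_zero_of_le_zero (hb _ (C.seq_le_left _ _) ?_)
  rw [C.comm_compl b b rfl]
  exact C.seq_le_left _ _

theorem IsSharp.seq_self {b : E} (hb : C.IsSharp b) : C.seq b b = b := by
  simpa only [hb.seq_compl, C.oplus_zero] using C.seq_oplus_seq_compl b b

theorem IsSharp.comm_of_le {a b : E} (hb : C.IsSharp b) (h : C.le a b) :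
    C.seq a b = C.seq b a := by
  obtain ⟨c, hp, hc⟩ := h
  have h0 : C.seq (C.compl b) a = C.zero := by
    refine C.eq_zero_of_oplus_eq_zero (C.seq_perp (C.compl b) _ _ hp) ?_
    rw [← C.seq_oplus _ _ _ hp, hc, ← C.comm_compl b b rfl, hb.seq_compl]
  have h1 := C.comm_compl a (C.compl b) (C.seq_eq_zero_comm _ _ h0)
  rwa [C.compl_compl] at h1

theorem eq_zero_or_one_of_smul_mul_self {r : ℝ} {a : E} (ha : a ≠ C.zero) (h0 : 0 ≤ r)
    (h1 : r ≤ 1) (h : C.smul (r * r) a = C.smul r a) : r = 0 ∨ r = 1 := by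
  by_contra! hr
  have hr0 : 0 < r := lt_of_le_of_ne h0 hr.1.symm
  have hr1 : r < 1 := lt_of_le_of_ne h1 hr.2
  have hd : 0 < r - r * r := by nlinarith
  have hsum : r * r + (r - r * r) ≤ 1 := by linarith
  have hs := C.add_smul (r * r) (r - r * r) a (by positivity) hd.le hsum
  rw [add_sub_cancel, ← h] at hs
  refine ha (C.eq_zero_of_smul_eq_zero hd (by nlinarith) ?_)
  exact C.oplus_left_cancel (C.perp_smul_self _ _ a (by positivity) hd.le hsum)
    (C.perp_zero _) (hs.symm.trans (C.oplus_zero _).symm)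

end COSEA

/-- for one-dimensional `a` and sharp `b`, `a ∣ b` iff `a∘b = 0` or `a ≤ b`. -/
theorem oneDim_comm_sharp_iff {E : Type u} (C : COSEA E) (a b : E)
    (ha : C.IsOneDim a) (hb : C.IsSharp b) :
    C.seq a b = C.seq b a ↔ C.seq a b = C.zero ∨ C.le a b := by
  constructor
  · intro hab
    obtain ⟨-, ha0, hdim⟩ := ha
    obtain ⟨r, h0, h1, hr⟩ := hdim _ (C.seq_le_left a b)
    have hba : C.seq b a = C.smul r a := hab.symm.trans hr
    have hidem := C.comm_assoc b b a rfl
    rw [hb.seq_self, hba, C.seq_smul _ _ _ h0 h1, hba, C.smul_smul _ _ _ h0 h1 h0 h1] at hidem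
    rcases COSEA.eq_zero_or_one_of_smul_mul_self ha0 h0 h1 hidem with rfl | rfl
    · exact Or.inl (hr.trans (C.zero_smul a))
    · right
      rw [C.one_smul] at hba
      simpa only [hba] using C.seq_le_left b a
  · rintro (h | h)
    · exact (C.seq_eq_zero_comm _ _ h).symm
    · exact hb.comm_of_le h
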